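/- Let g and f be smooth ℝ²-valued functions on 𝕋³ such that ∫₀¹ ∇_h·g(x',z) dz = 0 for all x' and 𝒫f = f. Then ⟨Q(g,f), f⟩ = 0, and consequently ⟨𝒫Q(g,f), f⟩ = 0. -/

import Mathlib

/-!
We model functions on the torus `𝕋³ = ℝ³/ℤ³` as smooth functions `ℝ³ → ℝ` that are
`1`-periodic in each variable; `L²(𝕋³)` integrals are taken over the fundamental
cube `[0,1]³`.
-/

noncomputable section

open scoped BigOperators
open MeasureTheory

/-- Points of `ℝ³`, with coordinates `(x₁, x₂, z)`. -/
abbrev Pt : Type := Fin 3 → ℝ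

/-- The fundamental cube `[0,1]³`. -/
def cube : Set Pt := Set.Icc 0 1

/-- `1`-periodicity in each of the three variables. -/
def PeriodicFn (f : Pt → ℝ) : Prop :=
  ∀ (x : Pt) (m : Fin 3 → ℤ), f (x + fun i => (m i : ℝ)) = f x

/-- A smooth function on the torus `𝕋³`. -/
def SmoothPer (f : Pt → ℝ) : Prop := ContDiff ℝ (⊤ : ℕ∞) f ∧ PeriodicFn f

/-- The partial derivative `∂_j`. -/
def pderiv3 (j : Fin 3) (f : Pt → ℝ) : Pt → ℝ := fun x => fderiv ℝ f x (Pi.single j 1)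

/-- The `L²(𝕋³)` inner product. -/
def innerC (f g : Pt → ℝ) : ℝ := ∫ x in cube, f x * g x

/-- The `L²(𝕋³)` inner product of ℝ²-valued functions. -/
def innerCV (u v : Fin 2 → Pt → ℝ) : ℝ := ∑ i : Fin 2, innerC (u i) (v i)

/-- The `L²(𝕋³)` norm. -/
def l2n (f : Pt → ℝ) : ℝ := Real.sqrt (∫ x in cube, (f x) ^ 2)

/-- The `L²(𝕋³)` norm of an ℝ²-valued function. -/
def l2nV (u : Fin 2 → Pt → ℝ) : ℝ := Real.sqrt (∑ i : Fin 2, (l2n (u i)) ^ 2)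

/-- The horizontal divergence `∇_h·g = ∂_{x₁}g¹ + ∂_{x₂}g²`. -/
def divh (g : Fin 2 → Pt → ℝ) : Pt → ℝ :=
  fun x => pderiv3 0 (g 0) x + pderiv3 1 (g 1) x

/-- The vertical antiderivative `(x',z) ↦ ∫₀^z u(x',z̃) dz̃`. -/
def zint (u : Pt → ℝ) : Pt → ℝ :=
  fun x => ∫ t in (0:ℝ)..(x 2), u (Function.update x 2 t)

/-- The hydrostatic nonlinearity
`Q(g,f) = g·∇_h f − (∫₀^z ∇_h·g(x',z̃) dz̃) ∂_z f` (componentwise on ℝ²-valued `f`). -/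
def Qop (g f : Fin 2 → Pt → ℝ) : Fin 2 → Pt → ℝ := fun i x =>
  g 0 x * pderiv3 0 (f i) x + g 1 x * pderiv3 1 (f i) x
    - zint (divh g) x * pderiv3 2 (f i) x

/-- The `n`-th Fourier coefficient (frequency `2πn`). -/
def fcoeff (f : Pt → ℝ) (n : Fin 3 → ℤ) : ℂ :=
  ∫ x in cube,
    Complex.exp (-(2 * Real.pi * Complex.I) * ∑ i, (n i : ℂ) * (x i : ℂ)) * (f x : ℂ)

/-- The hydrostatic Leray projection `𝒫V = V − ∇_h Δ_h^{-1} ∇_h·V̄`, computed via the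
Fourier series of the barotropic part (the modes with vertical frequency `0`). -/
def hprojF (V : Fin 2 → Pt → ℝ) : Fin 2 → Pt → ℝ := fun i x =>
  V i x -
    (∑' m : Fin 2 → ℤ,
      (if m 0 = 0 ∧ m 1 = 0 then (0 : ℂ) else
        (m i : ℂ) * ((m 0 : ℂ) * fcoeff (V 0) ![m 0, m 1, 0] +
                     (m 1 : ℂ) * fcoeff (V 1) ![m 0, m 1, 0]) /
          (((m 0 : ℂ)) ^ 2 + ((m 1 : ℂ)) ^ 2)) *
      Complex.exp ((2 * Real.pi * Complex.I) *
        ((m 0 : ℂ) * (x 0 : ℂ) + (m 1 : ℂ) * (x 1 : ℂ)))).re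

lemma cont_intOn {E : Type*} [NormedAddCommGroup E] {H : Pt → E}
    (h : Continuous H) : IntegrableOn H cube volume := by
  unfold cube
  exact h.continuousOn.integrableOn_compact isCompact_Icc

lemma int_deriv_zero {E : Type*} [NormedAddCommGroup E] [NormedSpace ℝ E] [CompleteSpace E]
    (j : Fin 3) (H H' : Pt → E) (hc : Continuous H')
    (hd : ∀ x t, HasDerivAt (fun s => H (Function.update x j s)) (H' (Function.update x j t)) t)
    (hp : ∀ x, H (Function.update x j 1) = H (Function.update x j 0)) :
    ∫ x in cube, H' x = 0 := by
  set e := MeasurableEquiv.piFinSuccAbove (fun _ : Fin 3 => ℝ) j with he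
  have mp := volume_preserving_piFinSuccAbove (fun _ : Fin 3 => ℝ) j
  have hpre : cube = e ⁻¹' (Set.Icc (0:ℝ) 1 ×ˢ Set.Icc (0 : Fin 2 → ℝ) 1) := by
    ext x
    simp only [cube, Set.mem_preimage, Set.mem_prod, Set.mem_Icc, Pi.le_def]
    rw [Fin.forall_iff_succAbove j, Fin.forall_iff_succAbove (P := fun i => x i ≤ (1 : Pt) i) j]
    simp [he, MeasurableEquiv.piFinSuccAbove, Fin.insertNthEquiv, Fin.removeNth]
    tauto
  have hsymm : Continuous fun p : ℝ × (Fin 2 → ℝ) => e.symm p := by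
    have : (fun p : ℝ × (Fin 2 → ℝ) => e.symm p)
        = fun p : ℝ × (Fin 2 → ℝ) => (j.insertNth p.1 p.2 : Pt) := rfl
    rw [this]
    fun_prop
  have key := mp.setIntegral_preimage_emb e.measurableEmbedding (fun p => H' (e.symm p))
    (Set.Icc (0:ℝ) 1 ×ˢ Set.Icc (0 : Fin 2 → ℝ) 1)
  have key2 : ∫ x in cube, H' x = ∫ p in (Set.Icc (0:ℝ) 1 ×ˢ Set.Icc (0 : Fin 2 → ℝ) 1), H' (e.symm p) := by
    rw [← key, hpre]
    simp only [← he, MeasurableEquiv.symm_apply_apply]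
  rw [key2]
  have hint : IntegrableOn (fun p => H' (e.symm p)) (Set.Icc (0:ℝ) 1 ×ˢ Set.Icc (0 : Fin 2 → ℝ) 1) :=
    (hc.comp hsymm).continuousOn.integrableOn_compact (isCompact_Icc.prod isCompact_Icc)
  rw [Measure.volume_eq_prod, IntegrableOn, ← Measure.prod_restrict] at hint
  rw [Measure.volume_eq_prod, ← Measure.prod_restrict, integral_prod_symm _ hint]
  have : ∀ y : Fin 2 → ℝ, ∫ s in Set.Icc (0:ℝ) 1, H' (e.symm (s, y)) = 0 := by
    intro y
    have hu : ∀ s, e.symm (s, y) = Function.update (e.symm (0, y)) j s := by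
      intro s
      change (j.insertNth s y : Pt) = Function.update (j.insertNth (0:ℝ) y : Pt) j s
      simp
    have hu2 : (fun s => H' (e.symm (s, y)))
        = fun s => H' (Function.update (e.symm (0, y)) j s) := funext fun s => by rw [hu s]
    rw [hu2]
    rw [integral_Icc_eq_integral_Ioc, ← intervalIntegral.integral_of_le zero_le_one]
    rw [intervalIntegral.integral_eq_sub_of_hasDerivAt (fun t _ => hd _ t)]
    · rw [hp, sub_self]
    · apply Continuous.intervalIntegrable
      fun_prop
  simp [this]

lemma SmoothPer.cont {f : Pt → ℝ} (h : SmoothPer f) : Continuous f := h.1.continuous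

lemma SmoothPer.deriv {f : Pt → ℝ} (h : SmoothPer f) (j : Fin 3) : SmoothPer (pderiv3 j f) := by
  refine ⟨?_, ?_⟩
  · unfold pderiv3
    exact (h.1.fderiv_right (m := (⊤ : ℕ∞)) (by simp)).clm_apply contDiff_const
  · intro x m
    unfold pderiv3
    have : (fun y => f (y + fun i => (m i : ℝ))) = f := funext fun y => h.2 y m
    rw [← fderiv_comp_add_right, this]

lemma SmoothPer.add {f g : Pt → ℝ} (hf : SmoothPer f) (hg : SmoothPer g) :
    SmoothPer (fun x => f x + g x) :=
  ⟨hf.1.add hg.1, fun x m => by simp only [hf.2 x m, hg.2 x m]⟩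

lemma SmoothPer.sub {f g : Pt → ℝ} (hf : SmoothPer f) (hg : SmoothPer g) :
    SmoothPer (fun x => f x - g x) :=
  ⟨hf.1.sub hg.1, fun x m => by simp only [hf.2 x m, hg.2 x m]⟩

lemma SmoothPer.mul {f g : Pt → ℝ} (hf : SmoothPer f) (hg : SmoothPer g) :
    SmoothPer (fun x => f x * g x) :=
  ⟨hf.1.mul hg.1, fun x m => by simp only [hf.2 x m, hg.2 x m]⟩

lemma SmoothPer.hasDeriv {f : Pt → ℝ} (h : SmoothPer f) (j : Fin 3) (x : Pt) (t : ℝ) :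
    HasDerivAt (fun s => f (Function.update x j s)) (pderiv3 j f (Function.update x j t)) t := by
  have h1 : HasFDerivAt f (fderiv ℝ f (Function.update x j t)) (Function.update x j t) :=
    (h.1.differentiable (by simp) _).hasFDerivAt
  exact h1.comp_hasDerivAt t (hasDerivAt_update x j t)

lemma SmoothPer.upd {f : Pt → ℝ} (h : SmoothPer f) (j : Fin 3) (x : Pt) :
    f (Function.update x j 1) = f (Function.update x j 0) := by
  rw [← h.2 (Function.update x j 0) (Pi.single j 1)]
  congr 1
  ext i
  by_cases hi : i = j
  · subst hi; simp
  · simp [hi]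

lemma SmoothPer.divh {g : Fin 2 → Pt → ℝ} (hg : ∀ i, SmoothPer (g i)) : SmoothPer (divh g) :=
  ((hg 0).deriv 0).add ((hg 1).deriv 1)

lemma zint_cont {u : Pt → ℝ} (hu : Continuous u) : Continuous (zint u) := by
  unfold zint
  apply intervalIntegral.continuous_parametric_intervalIntegral_of_continuous
  · unfold Function.uncurry
    fun_prop
  · fun_prop

lemma zint_deriv {u : Pt → ℝ} (hu : Continuous u) (x : Pt) (t : ℝ) :
    HasDerivAt (fun s => zint u (Function.update x 2 s)) (u (Function.update x 2 t)) t := by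
  unfold zint
  simp only [Function.update_self, Function.update_idem]
  apply intervalIntegral.integral_hasDerivAt_right
  · apply Continuous.intervalIntegrable
    fun_prop
  · apply Continuous.stronglyMeasurableAtFilter
    fun_prop
  · apply Continuous.continuousAt
    fun_prop

lemma zint_zero (u : Pt → ℝ) (x : Pt) : zint u (Function.update x 2 0) = 0 := by
  simp [zint]

lemma part1 (g : Fin 2 → Pt → ℝ) (f : Pt → ℝ)
    (hg : ∀ i, SmoothPer (g i)) (hf : SmoothPer f)
    (hgc : ∀ x : Pt, (∫ t in (0:ℝ)..1, divh g (Function.update x 2 t)) = 0) :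
    ∫ x in cube, (g 0 x * pderiv3 0 f x + g 1 x * pderiv3 1 f x
      - zint (divh g) x * pderiv3 2 f x) * f x = 0 := by
  have hdc := (SmoothPer.divh hg).cont
  have hW := zint_cont hdc
  have hW1 : ∀ x, zint (divh g) (Function.update x 2 1) = 0 := by
    intro x; simpa [zint] using hgc x
  have c0 := (hg 0).cont
  have c1 := (hg 1).cont
  have cf := hf.cont
  have d0 := ((hg 0).deriv 0).cont
  have d1 := ((hg 1).deriv 1).cont
  have e0 := (hf.deriv 0).cont
  have e1 := (hf.deriv 1).cont
  have e2 := (hf.deriv 2).cont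
  have I0 := int_deriv_zero 0 (fun x => g 0 x * (f x * f x))
    (fun x => pderiv3 0 (g 0) x * (f x * f x) + g 0 x * (pderiv3 0 f x * f x + f x * pderiv3 0 f x))
    (by fun_prop)
    (fun x t => ((hg 0).hasDeriv 0 x t).fun_mul ((hf.hasDeriv 0 x t).fun_mul (hf.hasDeriv 0 x t)))
    (fun x => by simp only [(hg 0).upd, hf.upd])
  have I1 := int_deriv_zero 1 (fun x => g 1 x * (f x * f x))
    (fun x => pderiv3 1 (g 1) x * (f x * f x) + g 1 x * (pderiv3 1 f x * f x + f x * pderiv3 1 f x))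
    (by fun_prop)
    (fun x t => ((hg 1).hasDeriv 1 x t).fun_mul ((hf.hasDeriv 1 x t).fun_mul (hf.hasDeriv 1 x t)))
    (fun x => by simp only [(hg 1).upd, hf.upd])
  have I2 := int_deriv_zero 2 (fun x => zint (divh g) x * (f x * f x))
    (fun x => divh g x * (f x * f x) + zint (divh g) x * (pderiv3 2 f x * f x + f x * pderiv3 2 f x))
    (by fun_prop)
    (fun x t => (zint_deriv hdc x t).fun_mul ((hf.hasDeriv 2 x t).fun_mul (hf.hasDeriv 2 x t)))
    (fun x => by simp only [hW1, zint_zero, zero_mul])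
  have : ∀ x, (g 0 x * pderiv3 0 f x + g 1 x * pderiv3 1 f x
      - zint (divh g) x * pderiv3 2 f x) * f x = (1/2 : ℝ) *
    (((pderiv3 0 (g 0) x * (f x * f x) + g 0 x * (pderiv3 0 f x * f x + f x * pderiv3 0 f x)) +
    (pderiv3 1 (g 1) x * (f x * f x) + g 1 x * (pderiv3 1 f x * f x + f x * pderiv3 1 f x))) -
    (divh g x * (f x * f x) + zint (divh g) x * (pderiv3 2 f x * f x + f x * pderiv3 2 f x))) := by
    intro x
    simp only [divh]
    ring
  simp_rw [this]
  rw [integral_const_mul, integral_sub, integral_add, I0, I1, I2]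
  · simp
  all_goals exact cont_intOn (by fun_prop)

def ex (n : Fin 3 → ℤ) (x : Pt) : ℂ :=
  Complex.exp (-(2 * Real.pi * Complex.I) * ∑ i, (n i : ℂ) * (x i : ℂ))

lemma ex_cont (n : Fin 3 → ℤ) : Continuous (ex n) := by
  unfold ex
  fun_prop

lemma ex_norm (n : Fin 3 → ℤ) (x : Pt) : ‖ex n x‖ = 1 := by
  have : ex n x = Complex.exp (((-(2 * Real.pi) * ∑ i, (n i : ℝ) * x i : ℝ) : ℂ) * Complex.I) := by
    unfold ex
    congr 1
    push_cast
    ring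
  rw [this, Complex.norm_exp_ofReal_mul_I]

lemma ex_upd (n : Fin 3 → ℤ) (j : Fin 3) (x : Pt) (s : ℝ) :
    ex n (Function.update x j s) = ex n (Function.update x j 0) *
      Complex.exp (-(2 * Real.pi * Complex.I) * (n j : ℂ) * (s : ℂ)) := by
  unfold ex
  rw [← Complex.exp_add]
  congr 1
  fin_cases j <;> simp [Fin.sum_univ_three, Function.update] <;> ring

lemma ex_per (n : Fin 3 → ℤ) (j : Fin 3) (x : Pt) :
    ex n (Function.update x j 1) = ex n (Function.update x j 0) := by
  rw [ex_upd]
  have : -(2 * Real.pi * Complex.I) * (n j : ℂ) * ((1 : ℝ) : ℂ)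
      = ((-(n j) : ℤ) : ℂ) * (2 * Real.pi * Complex.I) := by
    push_cast; ring
  rw [this, Complex.exp_int_mul_two_pi_mul_I, mul_one]

lemma ex_deriv (n : Fin 3 → ℤ) (j : Fin 3) (x : Pt) (t : ℝ) :
    HasDerivAt (fun s => ex n (Function.update x j s))
      (-(2 * Real.pi * Complex.I) * (n j : ℂ) * ex n (Function.update x j t)) t := by
  have h1 : HasDerivAt (fun s : ℝ => Complex.exp (-(2 * Real.pi * Complex.I) * (n j : ℂ) * (s : ℂ)))
      (Complex.exp (-(2 * Real.pi * Complex.I) * (n j : ℂ) * (t : ℂ)) *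
        (-(2 * Real.pi * Complex.I) * (n j : ℂ) * 1)) t :=
    ((Complex.ofRealCLM.hasDerivAt (x := t)).const_mul _).cexp
  have h2 := h1.const_mul (ex n (Function.update x j 0))
  have e1 : (fun s => ex n (Function.update x j s)) = fun s : ℝ => ex n (Function.update x j 0) *
      Complex.exp (-(2 * Real.pi * Complex.I) * (n j : ℂ) * (s : ℂ)) := funext fun s => ex_upd n j x s
  have e2 : -(2 * Real.pi * Complex.I) * (n j : ℂ) * ex n (Function.update x j t) =
      ex n (Function.update x j 0) *
      (Complex.exp (-(2 * Real.pi * Complex.I) * (n j : ℂ) * (t : ℂ)) *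
        (-(2 * Real.pi * Complex.I) * (n j : ℂ) * 1)) := by
    rw [ex_upd n j x t]
    ring
  rw [e1, e2]
  exact h2

lemma fcoeff_eq (f : Pt → ℝ) (n : Fin 3 → ℤ) : fcoeff f n = ∫ x in cube, ex n x * (f x : ℂ) := rfl

lemma fcoeff_deriv {V : Pt → ℝ} (hV : SmoothPer V) (j : Fin 3) (n : Fin 3 → ℤ) :
    fcoeff (pderiv3 j V) n = (2 * Real.pi * Complex.I) * (n j : ℂ) * fcoeff V n := by
  have ce := ex_cont n
  have cV := hV.cont
  have cd := (hV.deriv j).cont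
  have I := int_deriv_zero j (fun x => ex n x * (V x : ℂ))
    (fun x => -(2 * Real.pi * Complex.I) * (n j : ℂ) * ex n x * (V x : ℂ)
      + ex n x * (pderiv3 j V x : ℂ)) (by fun_prop)
    (fun x t => (ex_deriv n j x t).fun_mul (hV.hasDeriv j x t).ofReal_comp)
    (fun x => by simp only [ex_per, hV.upd])
  rw [integral_add (cont_intOn (by fun_prop)) (cont_intOn (by fun_prop))] at I
  simp_rw [mul_assoc (-(2 * Real.pi * Complex.I) * (n j : ℂ))] at I
  rw [integral_const_mul] at I
  rw [fcoeff_eq, fcoeff_eq]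
  linear_combination I

lemma fcoeff_add {u v : Pt → ℝ} (hu : Continuous u) (hv : Continuous v) (n : Fin 3 → ℤ) :
    fcoeff (fun x => u x + v x) n = fcoeff u n + fcoeff v n := by
  have ce := ex_cont n
  simp only [fcoeff_eq]
  rw [← integral_add (cont_intOn (by fun_prop)) (cont_intOn (by fun_prop))]
  congr 1; ext x; push_cast; ring

lemma fcoeff_sub {u v : Pt → ℝ} (hu : Continuous u) (hv : Continuous v) (n : Fin 3 → ℤ) :
    fcoeff (fun x => u x - v x) n = fcoeff u n - fcoeff v n := by
  have ce := ex_cont n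
  simp only [fcoeff_eq]
  rw [← integral_sub (cont_intOn (by fun_prop)) (cont_intOn (by fun_prop))]
  congr 1; ext x; push_cast; ring

lemma fcoeff_lap {V : Pt → ℝ} (hV : SmoothPer V) (j : Fin 3) (n : Fin 3 → ℤ) :
    fcoeff (fun x => V x - pderiv3 j (pderiv3 j V) x) n
      = ((1 + 4 * Real.pi ^ 2 * (n j : ℝ) ^ 2 : ℝ) : ℂ) * fcoeff V n := by
  rw [fcoeff_sub hV.cont ((hV.deriv j).deriv j).cont, fcoeff_deriv (hV.deriv j), fcoeff_deriv hV]
  push_cast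
  linear_combination (-(4 * (Real.pi : ℂ) ^ 2 * (n j : ℂ) ^ 2 * fcoeff V n)) * Complex.I_sq

lemma fcoeff_bound (V : Pt → ℝ) (n : Fin 3 → ℤ) :
    ‖fcoeff V n‖ ≤ ∫ x in cube, |V x| := by
  rw [fcoeff_eq]
  refine (norm_integral_le_integral_norm _).trans (le_of_eq ?_)
  simp [ex_norm]

lemma summable_one : Summable fun n : ℤ => 1 / (1 + 4 * Real.pi ^ 2 * (n : ℝ) ^ 2) := by
  have h1 : Summable fun n : ℤ => 1 / (n : ℝ) ^ 2 + (if n = 0 then (1 : ℝ) else 0) :=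
    (Real.summable_one_div_int_pow.2 one_lt_two).add (summable_of_ne_finset_zero (s := {0})
      (fun b hb => by simp at hb; simp [hb]))
  refine Summable.of_nonneg_of_le (fun n => by positivity) (fun n => ?_) h1
  by_cases hn : n = 0
  · simp [hn]
  · simp only [hn, if_false, add_zero]
    have hn2 : (0 : ℝ) < (n : ℝ) ^ 2 := by positivity
    apply one_div_le_one_div_of_le hn2
    have : (1:ℝ) ≤ Real.pi ^ 2 := by nlinarith [Real.pi_gt_three]
    nlinarith

lemma summable_coeff {V : Pt → ℝ} (hV : SmoothPer V) :
    Summable fun m : Fin 2 → ℤ => ‖fcoeff V ![m 0, m 1, 0]‖ := by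
  set V1 := fun x => V x - pderiv3 0 (pderiv3 0 V) x with hV1d
  have hV1 : SmoothPer V1 := hV.sub ((hV.deriv 0).deriv 0)
  set C := ∫ x in cube, |V1 x - pderiv3 1 (pderiv3 1 V1) x|
  have hs : Summable fun p : ℤ × ℤ => (1 / (1 + 4 * Real.pi ^ 2 * (p.1 : ℝ) ^ 2)) *
      (1 / (1 + 4 * Real.pi ^ 2 * (p.2 : ℝ) ^ 2)) :=
    Summable.mul_of_nonneg summable_one summable_one (fun n => by positivity) (fun n => by positivity)
  have hs2 := ((finTwoArrowEquiv ℤ).summable_iff.2 hs).mul_left C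
  refine Summable.of_nonneg_of_le (fun n => norm_nonneg _) (fun m => ?_) hs2
  have hb := fcoeff_bound (fun x => V1 x - pderiv3 1 (pderiv3 1 V1) x) ![m 0, m 1, 0]
  rw [fcoeff_lap hV1, hV1d, fcoeff_lap hV, norm_mul, norm_mul, Complex.norm_real, Complex.norm_real,
    Real.norm_of_nonneg (by positivity), Real.norm_of_nonneg (by positivity)] at hb
  simp only [Matrix.cons_val_zero, Matrix.cons_val_one] at hb
  change _ ≤ C * ((1 / (1 + 4 * Real.pi ^ 2 * (m 0 : ℝ) ^ 2)) *
      (1 / (1 + 4 * Real.pi ^ 2 * (m 1 : ℝ) ^ 2)))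
  have p0 : 0 < 1 + 4 * Real.pi ^ 2 * (m 0 : ℝ) ^ 2 := by positivity
  have p1 : 0 < 1 + 4 * Real.pi ^ 2 * (m 1 : ℝ) ^ 2 := by positivity
  rw [one_div_mul_one_div, mul_one_div, le_div_iff₀ (by positivity)]
  refine le_trans (le_of_eq ?_) hb
  ring

/-- The coefficients in the correction term. -/
def cf (A : (Fin 2 → ℤ) → Fin 2 → ℂ) (i : Fin 2) (m : Fin 2 → ℤ) : ℂ :=
  if m 0 = 0 ∧ m 1 = 0 then (0 : ℂ) else
        (m i : ℂ) * ((m 0 : ℂ) * A m 0 + (m 1 : ℂ) * A m 1) /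
          (((m 0 : ℂ)) ^ 2 + ((m 1 : ℂ)) ^ 2)

def ce (m : Fin 2 → ℤ) (x : Pt) : ℂ := Complex.exp ((2 * Real.pi * Complex.I) *
        ((m 0 : ℂ) * (x 0 : ℂ) + (m 1 : ℂ) * (x 1 : ℂ)))

lemma ce_eq (m : Fin 2 → ℤ) (x : Pt) : ce m x = (starRingEnd ℂ) (ex ![m 0, m 1, 0] x) := by
  unfold ce ex
  rw [← Complex.exp_conj]
  congr 1
  have h2 : (starRingEnd ℂ) 2 = 2 := map_ofNat _ 2
  simp [Fin.sum_univ_three, Complex.conj_ofReal, h2]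

lemma ce_norm (m : Fin 2 → ℤ) (x : Pt) : ‖ce m x‖ = 1 := by
  rw [ce_eq, RCLike.norm_conj, ex_norm]

lemma ce_cont (m : Fin 2 → ℤ) : Continuous (ce m) := by
  unfold ce; fun_prop

lemma cf_bound (A : (Fin 2 → ℤ) → Fin 2 → ℂ) (i : Fin 2) (m : Fin 2 → ℤ) :
    ‖cf A i m‖ ≤ ‖A m 0‖ + ‖A m 1‖ := by
  unfold cf
  split_ifs with h
  · simp; positivity
  · have hpos : (0 : ℝ) < (m 0 : ℝ) ^ 2 + (m 1 : ℝ) ^ 2 := by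
      by_cases h0 : m 0 = 0
      · have h1 : m 1 ≠ 0 := fun h1 => h ⟨h0, h1⟩
        positivity
      · positivity
    have hd : ‖((m 0 : ℂ)) ^ 2 + ((m 1 : ℂ)) ^ 2‖ = (m 0 : ℝ) ^ 2 + (m 1 : ℝ) ^ 2 := by
      have : ((m 0 : ℂ)) ^ 2 + ((m 1 : ℂ)) ^ 2 = (((m 0 : ℝ) ^ 2 + (m 1 : ℝ) ^ 2 : ℝ) : ℂ) := by
        push_cast; rfl
      rw [this, Complex.norm_real, Real.norm_of_nonneg hpos.le]
    rw [norm_div, hd, div_le_iff₀ hpos, norm_mul]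
    have hn : ‖(m 0 : ℂ) * A m 0 + (m 1 : ℂ) * A m 1‖ ≤ |(m 0 : ℝ)| * ‖A m 0‖ + |(m 1 : ℝ)| * ‖A m 1‖ := by
      refine (norm_add_le _ _).trans (le_of_eq ?_)
      simp
    have hi : ‖(m i : ℂ)‖ = |(m i : ℝ)| := by simp
    rw [hi]
    refine (mul_le_mul_of_nonneg_left hn (abs_nonneg _)).trans ?_
    have key : ∀ k : Fin 2, |(m i : ℝ)| * |(m k : ℝ)| ≤ (m 0 : ℝ) ^ 2 + (m 1 : ℝ) ^ 2 := by
      intro k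
      rw [← sq_abs (m 0 : ℝ), ← sq_abs (m 1 : ℝ)]
      fin_cases i <;> fin_cases k <;>
        simp only [Fin.zero_eta, Fin.mk_one] <;>
        nlinarith [sq_nonneg (|(m 0 : ℝ)| - |(m 1 : ℝ)|), sq_nonneg (|(m 0 : ℝ)|), sq_nonneg (|(m 1 : ℝ)|)]
    have k0 := mul_le_mul_of_nonneg_right (key 0) (norm_nonneg (A m 0))
    have k1 := mul_le_mul_of_nonneg_right (key 1) (norm_nonneg (A m 1))
    nlinarith

lemma corr_inner (c : (Fin 2 → ℤ) → ℂ) (hc : Summable fun m => ‖c m‖) (f : Pt → ℝ)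
    (hf : Continuous f) :
    HasSum (fun m => (c m * (starRingEnd ℂ) (fcoeff f ![m 0, m 1, 0])).re)
      (innerC (fun x => (∑' m, c m * ce m x).re) f) ∧
    Integrable (fun x => (∑' m, c m * ce m x).re * f x) (volume.restrict cube) := by
  have hint : ∀ m, IntegrableOn (fun x => c m * ce m x * (f x : ℂ)) cube := fun m =>
    cont_intOn (by have := ce_cont m; fun_prop)
  have hS : Continuous fun x => ∑' m, c m * ce m x := by
    refine continuous_tsum (fun m => by have := ce_cont m; fun_prop) hc (fun m x => ?_)
    rw [norm_mul, ce_norm, mul_one]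
  have h := hasSum_integral_of_summable_integral_norm (μ := volume.restrict cube) hint (by
    have : (fun m => ∫ x in cube, ‖c m * ce m x * (f x : ℂ)‖)
        = fun m => ‖c m‖ * ∫ x in cube, |f x| := by
      ext m
      rw [← integral_const_mul]
      congr 1; ext x
      rw [norm_mul, norm_mul, ce_norm, mul_one, Complex.norm_real, Real.norm_eq_abs]
    rw [this]
    exact hc.mul_right _)
  have h2 := Complex.hasSum_re h
  refine ⟨?_, cont_intOn (by fun_prop)⟩
  convert h2 using 1
  · ext m
    congr 1
    simp_rw [mul_assoc]
    rw [integral_const_mul, fcoeff_eq, ← integral_conj]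
    congr 2; ext x
    rw [ce_eq]; simp [Complex.conj_ofReal]
  · unfold innerC
    simp_rw [tsum_mul_right]
    rw [← RCLike.re_eq_complex_re, ← integral_re]
    · congr 1; ext x
      simp
    · exact cont_intOn (by fun_prop)

def dv (A : (Fin 2 → ℤ) → Fin 2 → ℂ) (m : Fin 2 → ℤ) : ℂ := (m 0 : ℂ) * A m 0 + (m 1 : ℂ) * A m 1

lemma cf_sum (A B : (Fin 2 → ℤ) → Fin 2 → ℂ) (m : Fin 2 → ℤ) :
    (cf A 0 m * (starRingEnd ℂ) (B m 0)).re + (cf A 1 m * (starRingEnd ℂ) (B m 1)).re =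
    (dv A m * (starRingEnd ℂ) (dv B m)).re / ((m 0 : ℝ) ^ 2 + (m 1 : ℝ) ^ 2) := by
  rw [← Complex.add_re, ← Complex.div_ofReal_re]
  congr 1
  unfold cf dv
  split_ifs with h
  · simp [h.1, h.2]
  · simp
    ring

/-- Fourier coefficients of the barotropic part. -/
def fc (V : Fin 2 → Pt → ℝ) : (Fin 2 → ℤ) → Fin 2 → ℂ := fun m i => fcoeff (V i) ![m 0, m 1, 0]

lemma hproj_inner (V f : Fin 2 → Pt → ℝ) (hV : ∀ i, Continuous (V i))
    (hs : ∀ i, Summable fun m => ‖fc V m i‖) (hf : ∀ i, Continuous (f i)) :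
    HasSum (fun m => (dv (fc V) m * (starRingEnd ℂ) (dv (fc f) m)).re /
      ((m 0 : ℝ) ^ 2 + (m 1 : ℝ) ^ 2)) (innerCV V f - innerCV (hprojF V) f) := by
  have hcs : ∀ i, Summable fun m => ‖cf (fc V) i m‖ := fun i =>
    Summable.of_nonneg_of_le (fun m => norm_nonneg _) (fun m => cf_bound _ i m) ((hs 0).add (hs 1))
  have h0 := corr_inner _ (hcs 0) (f 0) (hf 0)
  have h1 := corr_inner _ (hcs 1) (f 1) (hf 1)
  have hP : ∀ i x, hprojF V i x = V i x - (∑' m, cf (fc V) i m * ce m x).re := fun i x => rfl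
  have hI : ∀ i, Integrable (fun x => (∑' m, cf (fc V) i m * ce m x).re * f i x)
      (volume.restrict cube) → innerC (hprojF V i) (f i) = innerC (V i) (f i) -
      innerC (fun x => (∑' m, cf (fc V) i m * ce m x).re) (f i) := by
    intro i hi
    unfold innerC
    rw [← integral_sub (cont_intOn (by have := hV i; have := hf i; fun_prop)) hi]
    congr 1; ext x
    rw [hP]; ring
  have hval : innerCV V f - innerCV (hprojF V) f =
      innerC (fun x => (∑' m, cf (fc V) 0 m * ce m x).re) (f 0) +
      innerC (fun x => (∑' m, cf (fc V) 1 m * ce m x).re) (f 1) := by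
    unfold innerCV
    rw [Fin.sum_univ_two, Fin.sum_univ_two, hI 0 h0.2, hI 1 h1.2]
    ring
  rw [hval]
  convert h0.1.add h1.1 using 1
  ext m
  exact (cf_sum (fc V) (fc f) m).symm

lemma fcoeff_Q (g f : Fin 2 → Pt → ℝ) (hg : ∀ i, SmoothPer (g i)) (hf : ∀ i, SmoothPer (f i))
    (hgc : ∀ x : Pt, (∫ t in (0:ℝ)..1, divh g (Function.update x 2 t)) = 0)
    (i : Fin 2) (n : Fin 3 → ℤ) (hn : n 2 = 0) :
    fcoeff (Qop g f i) n = fcoeff (fun x => (g 0 x * pderiv3 0 (f i) x + g 1 x * pderiv3 1 (f i) x)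
      + divh g x * f i x) n := by
  have hdc := (SmoothPer.divh hg).cont
  have hW := zint_cont hdc
  have hW1 : ∀ x, zint (divh g) (Function.update x 2 1) = 0 := by
    intro x; simpa [zint] using hgc x
  have c0 := (hg 0).cont
  have c1 := (hg 1).cont
  have cf := (hf i).cont
  have e0 := ((hf i).deriv 0).cont
  have e1 := ((hf i).deriv 1).cont
  have e2 := ((hf i).deriv 2).cont
  have cx := ex_cont n
  have I := int_deriv_zero 2 (fun x => ex n x * ((zint (divh g) x * f i x : ℝ) : ℂ))
    (fun x => -(2 * Real.pi * Complex.I) * (n 2 : ℂ) * ex n x * ((zint (divh g) x * f i x : ℝ) : ℂ)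
      + ex n x * ((divh g x * f i x + zint (divh g) x * pderiv3 2 (f i) x : ℝ) : ℂ)) (by fun_prop)
    (fun x t => (ex_deriv n 2 x t).fun_mul
      ((zint_deriv hdc x t).fun_mul ((hf i).hasDeriv 2 x t)).ofReal_comp)
    (fun x => by simp only [hW1, zint_zero, zero_mul, Complex.ofReal_zero, mul_zero])
  simp only [hn, Int.cast_zero, mul_zero, zero_mul, zero_add] at I
  have I' : fcoeff (fun x => divh g x * f i x + zint (divh g) x * pderiv3 2 (f i) x) n = 0 := I
  have hQ : Qop g f i = fun x => (g 0 x * pderiv3 0 (f i) x + g 1 x * pderiv3 1 (f i) x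
      + divh g x * f i x) - (divh g x * f i x + zint (divh g) x * pderiv3 2 (f i) x) := by
    ext x; simp only [Qop]; ring
  rw [hQ, fcoeff_sub (by fun_prop) (by fun_prop), I', sub_zero]

/-- Let `g, f` be smooth ℝ²-valued functions on `𝕋³` with
`∫₀¹ ∇_h·g(x',z) dz = 0` for all `x'` and `𝒫f = f`. Then `⟨Q(g,f), f⟩ = 0`, and
consequently `⟨𝒫Q(g,f), f⟩ = 0`. -/
theorem stmt10 (g f : Fin 2 → Pt → ℝ)
    (hg : ∀ i, SmoothPer (g i)) (hf : ∀ i, SmoothPer (f i))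
    (hgc : ∀ x : Pt, (∫ t in (0:ℝ)..1, divh g (Function.update x 2 t)) = 0)
    (hPf : hprojF f = f) :
    innerCV (Qop g f) f = 0 ∧ innerCV (hprojF (Qop g f)) f = 0 := by
  have hfc : ∀ i, Continuous (f i) := fun i => (hf i).cont
  have h1 : innerCV (Qop g f) f = 0 := by
    unfold innerCV
    refine Finset.sum_eq_zero fun i _ => ?_
    exact part1 g (f i) hg (hf i) hgc
  refine ⟨h1, ?_⟩
  -- the barotropic part of `f` is divergence free
  have hff := hproj_inner f f hfc (fun i => summable_coeff (hf i)) hfc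
  rw [hPf, sub_self] at hff
  have hz := (hasSum_zero_iff_of_nonneg (fun m => by
    rw [Complex.mul_conj, Complex.ofReal_re]
    have := Complex.normSq_nonneg (dv (fc f) m)
    positivity)).1 hff
  have hdiv : ∀ m, dv (fc f) m = 0 := by
    intro m
    have hm := congrFun hz m
    simp only [Pi.zero_apply, Complex.mul_conj, Complex.ofReal_re] at hm
    rcases div_eq_zero_iff.1 hm with h | h
    · exact Complex.normSq_eq_zero.1 h
    · have a0 : (m 0 : ℝ) = 0 := by nlinarith [sq_nonneg (m 0 : ℝ), sq_nonneg (m 1 : ℝ)]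
      have a1 : (m 1 : ℝ) = 0 := by nlinarith [sq_nonneg (m 0 : ℝ), sq_nonneg (m 1 : ℝ)]
      have b0 : m 0 = 0 := by exact_mod_cast a0
      have b1 : m 1 = 0 := by exact_mod_cast a1
      simp [dv, b0, b1]
  have hQc : ∀ i, Continuous (Qop g f i) := by
    intro i
    have hW := zint_cont (SmoothPer.divh hg).cont
    have c0 := (hg 0).cont
    have c1 := (hg 1).cont
    have e0 := ((hf i).deriv 0).cont
    have e1 := ((hf i).deriv 1).cont
    have e2 := ((hf i).deriv 2).cont
    unfold Qop
    fun_prop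
  have hQs : ∀ i, Summable fun m => ‖fc (Qop g f) m i‖ := by
    intro i
    have hR := summable_coeff ((((hg 0).mul ((hf i).deriv 0)).add ((hg 1).mul ((hf i).deriv 1))).add
      ((SmoothPer.divh hg).mul (hf i)))
    refine hR.congr fun m => ?_
    unfold fc
    rw [fcoeff_Q g f hg hf hgc i _ (by simp)]
  have hQ := hproj_inner (Qop g f) f hQc hQs hfc
  simp only [hdiv, map_zero, mul_zero, Complex.zero_re, zero_div] at hQ
  have := hQ.unique hasSum_zero
  linarith
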